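/- Let n ≥ 2, 1 ≤ p < n and p* = np/(n-p). There is a constant C = C(n,p) such that for every cube Q₀ ⊂ ℝⁿ with |Q₀| = 1 and every f ∈ L¹(Q₀), one has sup_{λ>0} λ · |{x ∈ Q₀ : |f(x) − f_{Q₀}| > λ}|^{1/p*} ≤ C · ‖f‖_{𝒪ᵖ(Q₀)}. In other words, ‖f − f_{Q₀}‖_{L^{p*,∞}(Q₀)} ≲ ‖f‖_{𝒪ᵖ(Q₀)}. -/

import Mathlib

open MeasureTheory Set
open scoped ENNReal Classical

noncomputable section

/-- The unit cube in `ℝⁿ` with lower-left corner `c`. -/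
def unitCube (n : ℕ) (c : Fin n → ℝ) : Set (Fin n → ℝ) :=
  Set.univ.pi fun i => Set.Ico (c i) (c i + 1)

/-- The dyadic subcube of generation `k` and index `j` (sidelength `2 ^ (-k)`)
of the unit cube with corner `c`; it is a genuine subcube when `∀ i, j i < 2 ^ k`. -/
def dsub (n : ℕ) (c : Fin n → ℝ) (k : ℕ) (j : Fin n → ℕ) : Set (Fin n → ℝ) :=
  Set.univ.pi fun i => Set.Ico (c i + (j i : ℝ) / 2 ^ k) (c i + ((j i : ℝ) + 1) / 2 ^ k)

/-- The mean oscillation `O(f,E) = ⨍_E |f - ⨍_E f|` (w.r.t. Lebesgue measure). -/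
def osc {n : ℕ} (f : (Fin n → ℝ) → ℝ) (E : Set (Fin n → ℝ)) : ℝ :=
  ⨍ x in E, |f x - ⨍ y in E, f y|

/-- The `p`-th power of the quasi-norm `‖f‖_{𝒪^p(Q₀)}`, where `Q₀` is the unit cube with
corner `c`:  `sup_{λ>0} λ^p ∑_{Q ∈ 𝒟(Q₀), O(f,Q) > λ} ℓ(Q)^{-p} |Q|`. -/
def OpNormPow (n : ℕ) (c : Fin n → ℝ) (p : ℝ) (f : (Fin n → ℝ) → ℝ) : ℝ≥0∞ :=
  ⨆ l ∈ Set.Ioi (0 : ℝ), ENNReal.ofReal (l ^ p) *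
    ∑' (k : ℕ) (j : Fin n → ℕ),
      if (∀ i, j i < 2 ^ k) ∧ l < osc f (dsub n c k j) then
        ENNReal.ofReal (((2 : ℝ) ^ (-(k : ℤ))) ^ (-p)) * volume (dsub n c k j) else 0

/-- The index of the dyadic subcube of generation `k` containing `x`. -/
def dyadicIndex {n : ℕ} (c : Fin n → ℝ) (k : ℕ) (x : Fin n → ℝ) : Fin n → ℕ :=
  fun i => ⌊(x i - c i) * 2 ^ k⌋₊

/-- The dyadic subcube of generation `k` containing `x`. -/
def dyadicCube {n : ℕ} (c : Fin n → ℝ) (k : ℕ) (x : Fin n → ℝ) : Set (Fin n → ℝ) :=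
  dsub n c k (dyadicIndex c k x)

/-- The union of the dyadic subcubes of generation `k` on which the oscillation of `f`
exceeds `s`. -/
def oscSuperlevel {n : ℕ} (c : Fin n → ℝ) (f : (Fin n → ℝ) → ℝ) (k : ℕ) (s : ℝ) :
    Set (Fin n → ℝ) :=
  ⋃ j : Fin n → ℕ, if (∀ i, j i < 2 ^ k) ∧ s < osc f (dsub n c k j) then dsub n c k j else ∅

section DyadicCubes

variable {n : ℕ} {c : Fin n → ℝ} {k : ℕ} {x : Fin n → ℝ}

lemma measurableSet_dsub (j : Fin n → ℕ) : MeasurableSet (dsub n c k j) :=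
  MeasurableSet.univ_pi fun _ => measurableSet_Ico

lemma volume_dsub (j : Fin n → ℕ) :
    volume (dsub n c k j) = ENNReal.ofReal ((2 ^ k)⁻¹ ^ n) := by
  have h (i : Fin n) :
      c i + ((j i : ℝ) + 1) / 2 ^ k - (c i + (j i : ℝ) / 2 ^ k) = (2 ^ k)⁻¹ := by
    field_simp
    ring
  simp only [dsub, Real.volume_pi_Ico, h, Finset.prod_const, Finset.card_univ, Fintype.card_fin]
  rw [ENNReal.ofReal_pow (by positivity)]

lemma unitCube_eq_dsub : unitCube n c = dsub n c 0 0 := by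
  simp [unitCube, dsub]

lemma volume_unitCube : volume (unitCube n c) = 1 := by
  simp [unitCube_eq_dsub, volume_dsub]

lemma sub_mem_Ico_of_mem_unitCube (hx : x ∈ unitCube n c) (i : Fin n) :
    x i - c i ∈ Ico (0 : ℝ) 1 := by
  have := hx i (mem_univ i)
  exact ⟨by linarith [this.1], by linarith [this.2]⟩

lemma mem_dyadicCube (hx : x ∈ unitCube n c) : x ∈ dyadicCube c k x := by
  intro i _
  have h := sub_mem_Ico_of_mem_unitCube hx i
  have h2 : (0 : ℝ) < 2 ^ k := by positivity
  have h₁ := Nat.floor_le (mul_nonneg h.1 h2.le)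
  have h₂ := Nat.lt_floor_add_one ((x i - c i) * 2 ^ k)
  rw [← div_le_iff₀ h2] at h₁
  rw [← lt_div_iff₀ h2] at h₂
  exact ⟨by simp only [dyadicIndex]; linarith, by simp only [dyadicIndex]; linarith⟩

lemma dyadicIndex_lt (hx : x ∈ unitCube n c) (i : Fin n) : dyadicIndex c k x i < 2 ^ k := by
  have h := sub_mem_Ico_of_mem_unitCube hx i
  have h2 : (0 : ℝ) < 2 ^ k := by positivity
  rw [dyadicIndex, Nat.floor_lt (mul_nonneg h.1 h2.le)]
  push_cast
  nlinarith [h.2]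

lemma dyadicCube_zero (hx : x ∈ unitCube n c) : dyadicCube c 0 x = unitCube n c := by
  have : dyadicIndex c 0 x = 0 := by
    ext i
    simpa using dyadicIndex_lt (k := 0) hx i
  rw [dyadicCube, this, unitCube_eq_dsub]

lemma dyadicCube_succ_subset : dyadicCube c (k + 1) x ⊆ dyadicCube c k x := by
  have key (i : Fin n) : dyadicIndex c (k + 1) x i / 2 = dyadicIndex c k x i := by
    simp only [dyadicIndex]
    rw [← Nat.floor_div_ofNat]
    congr 1
    rw [pow_succ]
    ring
  refine pi_mono fun i _ => Ico_subset_Ico ?_ ?_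
  · have h : (2 * dyadicIndex c k x i : ℝ) ≤ dyadicIndex c (k + 1) x i := by
      exact_mod_cast (by have := key i; lia :
        2 * dyadicIndex c k x i ≤ dyadicIndex c (k + 1) x i)
    rw [pow_succ, add_le_add_iff_left, div_le_div_iff₀ (by positivity) (by positivity)]
    nlinarith [pow_pos (two_pos : (0 : ℝ) < 2) k]
  · have h : (dyadicIndex c (k + 1) x i : ℝ) + 1 ≤ 2 * (dyadicIndex c k x i + 1) := by
      exact_mod_cast (by have := key i; lia :
        dyadicIndex c (k + 1) x i + 1 ≤ 2 * (dyadicIndex c k x i + 1))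
    rw [pow_succ, add_le_add_iff_left, div_le_div_iff₀ (by positivity) (by positivity)]
    nlinarith [pow_pos (two_pos : (0 : ℝ) < 2) k]

lemma dyadicCube_subset_unitCube (hx : x ∈ unitCube n c) : dyadicCube c k x ⊆ unitCube n c := by
  induction k with
  | zero => exact (dyadicCube_zero hx).subset
  | succ k ih => exact dyadicCube_succ_subset.trans ih

end DyadicCubes

lemma abs_setAverage_sub_setAverage_le {n : ℕ} {f : (Fin n → ℝ) → ℝ} {E Q : Set (Fin n → ℝ)}
    (hEQ : E ⊆ Q) (hE : 0 < volume.real E) (hQ : volume Q ≠ ∞) (hf : IntegrableOn f Q) :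
    |(⨍ x in E, f x) - ⨍ x in Q, f x| ≤ volume.real Q / volume.real E * osc f Q := by
  have hQ' : 0 < volume.real Q := hE.trans_le (measureReal_mono hEQ hQ)
  have hE' : volume E ≠ ∞ := measure_ne_top_of_subset hEQ hQ
  set m := ⨍ x in Q, f x
  have hint : IntegrableOn (fun x => f x - m) Q := hf.sub (integrableOn_const hQ)
  have h₁ : (⨍ x in E, f x) - m = (volume.real E)⁻¹ * ∫ x in E, (f x - m) := by
    rw [integral_sub (hf.mono_set hEQ) (integrableOn_const hE'), setAverage_eq,
      setIntegral_const]
    simp only [smul_eq_mul]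
    field_simp
  have h₂ : |∫ x in E, (f x - m)| ≤ ∫ x in Q, |f x - m| :=
    (abs_integral_le_integral_abs).trans
      (setIntegral_mono_set hint.abs (Filter.Eventually.of_forall fun _ => abs_nonneg _)
        hEQ.eventuallyLE)
  rw [h₁, abs_mul, abs_of_pos (inv_pos.2 hE), osc, setAverage_eq, smul_eq_mul]
  calc (volume.real E)⁻¹ * |∫ x in E, (f x - m)|
      ≤ (volume.real E)⁻¹ * ∫ x in Q, |f x - m| := by gcongr
    _ = _ := by
        simp only [m]
        field_simp

section Averages

variable {n : ℕ} {c : Fin n → ℝ} {f : (Fin n → ℝ) → ℝ}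

lemma abs_average_dyadicCube_succ_sub_le (hf : IntegrableOn f (unitCube n c)) {x : Fin n → ℝ}
    (hx : x ∈ unitCube n c) (k : ℕ) :
    |(⨍ y in dyadicCube c (k + 1) x, f y) - ⨍ y in dyadicCube c k x, f y|
      ≤ 2 ^ n * osc f (dyadicCube c k x) := by
  have hv (k : ℕ) : volume.real (dyadicCube c k x) = (2 ^ k)⁻¹ ^ n := by
    rw [Measure.real, dyadicCube, volume_dsub, ENNReal.toReal_ofReal (by positivity)]
  convert abs_setAverage_sub_setAverage_le (dyadicCube_succ_subset (c := c) (k := k) (x := x))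
    (by rw [hv]; positivity) (by rw [dyadicCube, volume_dsub]; exact ENNReal.ofReal_ne_top)
    (hf.mono_set (dyadicCube_subset_unitCube hx)) using 2
  rw [hv, hv, ← div_pow]
  congr 1
  field_simp
  ring

lemma abs_average_dyadicCube_sub_le (hf : IntegrableOn f (unitCube n c)) {x : Fin n → ℝ}
    (hx : x ∈ unitCube n c) (M : ℕ) :
    |(⨍ y in dyadicCube c M x, f y) - ⨍ y in unitCube n c, f y|
      ≤ 2 ^ n * ∑ k ∈ Finset.range M, osc f (dyadicCube c k x) := by
  induction M with
  | zero => simp [dyadicCube_zero hx]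
  | succ M ih =>
    rw [Finset.sum_range_succ, mul_add]
    exact (abs_sub_le _ (⨍ y in dyadicCube c M x, f y) _).trans (by
      linarith [abs_average_dyadicCube_succ_sub_le hf hx M])

lemma ae_tendsto_average_dyadicCube (hf : IntegrableOn f (unitCube n c)) :
    ∀ᵐ x, x ∈ unitCube n c →
      Filter.Tendsto (fun k => ⨍ y in dyadicCube c k x, f y) Filter.atTop (nhds (f x)) := by
  have hmeas : MeasurableSet (unitCube n c) := unitCube_eq_dsub (c := c) ▸ measurableSet_dsub 0
  have hg : LocallyIntegrable ((unitCube n c).indicator f) volume :=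
    ((integrable_indicator_iff hmeas).2 hf).locallyIntegrable
  filter_upwards [IsUnifLocDoublingMeasure.ae_tendsto_average volume hg 1] with x h hx
  set w : ℕ → Fin n → ℝ := fun k i => c i + ((dyadicIndex c k x i : ℝ) + 1 / 2) / 2 ^ k with hw
  set δ : ℕ → ℝ := fun k => (1 / 2) * (1 / 2) ^ k with hδ
  have hδ0 (k : ℕ) : 0 < δ k := by positivity
  have hball (k : ℕ) : dyadicCube c k x =ᵐ[volume] Metric.closedBall (w k) (δ k) := by
    have h₁ : Metric.closedBall (w k) (δ k) =
        Icc (fun i => c i + (dyadicIndex c k x i : ℝ) / 2 ^ k)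
          (fun i => c i + ((dyadicIndex c k x i : ℝ) + 1) / 2 ^ k) := by
      rw [closedBall_pi _ (hδ0 k).le, ← pi_univ_Icc]
      congr 1
      ext1 i
      rw [Real.closedBall_eq_Icc]
      simp only [hw, hδ, one_div, inv_pow]
      congr 1 <;> field_simp <;> ring
    rw [h₁]
    exact Measure.univ_pi_Ico_ae_eq_Icc
  have hsub (k : ℕ) : dyadicCube c k x ⊆ Metric.closedBall (w k) (δ k) := by
    intro y hy
    rw [closedBall_pi _ (hδ0 k).le]
    intro i hi
    have := hy i hi
    simp only [Real.closedBall_eq_Icc, mem_Icc, mem_Ico, hw, hδ, one_div, inv_pow, add_div] at this ⊢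
    have e : (1 : ℝ) / 2 ^ k = (2 ^ k)⁻¹ := one_div _
    have e' : (2⁻¹ : ℝ) / 2 ^ k = 2⁻¹ * (2 ^ k)⁻¹ := div_eq_mul_inv _ _
    constructor <;> linarith [this.1, this.2]
  have hlim : Filter.Tendsto δ Filter.atTop (nhdsWithin 0 (Ioi 0)) := by
    refine tendsto_nhdsWithin_iff.2 ⟨?_, Filter.Eventually.of_forall hδ0⟩
    simpa only [mul_zero] using (tendsto_pow_atTop_nhds_zero_of_lt_one (r := (1 / 2 : ℝ))
      (by norm_num) (by norm_num)).const_mul (1 / 2)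
  have := h w δ hlim (Filter.Eventually.of_forall fun k => by
    rw [one_mul]
    exact hsub k (mem_dyadicCube hx))
  rw [indicator_of_mem hx] at this
  refine this.congr fun k => ?_
  rw [← setAverage_congr (hball k)]
  refine setAverage_congr_fun (measurableSet_dsub _) (Filter.Eventually.of_forall fun y hy => ?_)
  exact indicator_of_mem (dyadicCube_subset_unitCube hx hy) f

/-- A bound, uniform in `M`, for the telescoping sums passes to the limit. -/
lemma ae_abs_sub_average_le (hf : IntegrableOn f (unitCube n c)) :
    ∀ᵐ x, x ∈ unitCube n c → ∀ S : ℝ,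
      (∀ M, ∑ k ∈ Finset.range M, osc f (dyadicCube c k x) ≤ S) →
      |f x - ⨍ y in unitCube n c, f y| ≤ 2 ^ n * S := by
  filter_upwards [ae_tendsto_average_dyadicCube hf] with x h hx S hS
  refine le_of_tendsto ((h hx).sub_const _).abs (Filter.Eventually.of_forall fun M => ?_)
  exact (abs_average_dyadicCube_sub_le hf hx M).trans (by gcongr; exact hS M)

end Averages

section WeakBounds

variable {n : ℕ} {c : Fin n → ℝ} {f : (Fin n → ℝ) → ℝ} {p B : ℝ}

lemma volume_oscSuperlevel_le (hB : 0 < B) (hA : OpNormPow n c p f ≤ ENNReal.ofReal (B ^ p))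
    (k : ℕ) {s : ℝ} (hs : 0 < s) :
    volume (oscSuperlevel c f k s) ≤ ENNReal.ofReal ((B / (s * 2 ^ k)) ^ p) := by
  have h2 : ((2 : ℝ) ^ (-(k : ℤ))) ^ (-p) = (2 ^ k) ^ p := by
    rw [zpow_neg, zpow_natCast, Real.inv_rpow (by positivity), Real.rpow_neg (by positivity),
      inv_inv]
  have hvol : volume (oscSuperlevel c f k s) ≤
      ∑' j : Fin n → ℕ, if (∀ i, j i < 2 ^ k) ∧ s < osc f (dsub n c k j) then
        volume (dsub n c k j) else 0 := by
    refine (measure_iUnion_le _).trans (ENNReal.tsum_le_tsum fun j => ?_)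
    split_ifs <;> simp
  have hsum : ENNReal.ofReal (s ^ p) *
      (ENNReal.ofReal ((2 ^ k) ^ p) * volume (oscSuperlevel c f k s)) ≤
        ENNReal.ofReal (B ^ p) := by
    refine le_trans ?_ ((le_iSup₂_of_le (f := fun l (_ : l ∈ Ioi (0 : ℝ)) => _) s hs le_rfl).trans
      hA)
    gcongr
    refine le_trans ?_ (ENNReal.le_tsum k)
    refine (mul_le_mul_right hvol _).trans ?_
    rw [← ENNReal.tsum_mul_left]
    refine ENNReal.tsum_le_tsum fun j => ?_
    rw [h2]
    split_ifs <;> simp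
  have hpos : 0 < (s * 2 ^ k) ^ p := by positivity
  rw [← mul_assoc, ← ENNReal.ofReal_mul (by positivity),
    ← Real.mul_rpow hs.le (by positivity)] at hsum
  rw [Real.div_rpow hB.le (by positivity), ENNReal.ofReal_div_of_pos hpos]
  rw [ENNReal.le_div_iff_mul_le (Or.inl (by simpa using hpos)) (Or.inl ENNReal.ofReal_ne_top),
    mul_comm]
  exact hsum

lemma dyadicCube_subset_oscSuperlevel {x : Fin n → ℝ} (hx : x ∈ unitCube n c) {k : ℕ} {s : ℝ}
    (h : s < osc f (dyadicCube c k x)) : dyadicCube c k x ⊆ oscSuperlevel c f k s := by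
  refine subset_trans ?_ (subset_iUnion _ (dyadicIndex c k x))
  rw [if_pos ⟨dyadicIndex_lt hx, h⟩, dyadicCube]

lemma inv_pow_rpow_eq (hp : 0 < p) (k : ℕ) :
    ((((2 : ℝ) ^ ((n - p) / p) * 2) ^ k)⁻¹) ^ p = (2 ^ k)⁻¹ ^ n := by
  have h : ((2 : ℝ) ^ ((n - p) / p) * 2) ^ p = 2 ^ n := by
    rw [← Real.rpow_add_one two_ne_zero, ← Real.rpow_mul zero_le_two, ← Real.rpow_natCast]
    congr 1
    field_simp
    ring
  rw [Real.inv_rpow (by positivity), ← Real.rpow_pow_comm (by positivity), h, inv_pow,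
    ← pow_mul, ← pow_mul, mul_comm]

lemma osc_dyadicCube_le (hp : 0 < p) (hB : 0 < B)
    (hA : OpNormPow n c p f ≤ ENNReal.ofReal (B ^ p)) {x : Fin n → ℝ}
    (hx : x ∈ unitCube n c) (k : ℕ) :
    osc f (dyadicCube c k x) ≤ B * ((2 : ℝ) ^ ((n - p) / p)) ^ k := by
  by_contra! h
  set r := (2 : ℝ) ^ ((n - p) / p) with hr
  have hr0 : 0 < r := by positivity
  obtain ⟨s, hs, hs'⟩ := exists_between h
  have hs0 : 0 < s := lt_trans (by positivity) hs
  have hle := (measure_mono (dyadicCube_subset_oscSuperlevel hx hs')).trans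
    (volume_oscSuperlevel_le hB hA k hs0)
  rw [dyadicCube, volume_dsub, ENNReal.ofReal_le_ofReal_iff (by positivity)] at hle
  have hlt : (B / (s * 2 ^ k)) ^ p < (B / (B * r ^ k * 2 ^ k)) ^ p := by
    gcongr
  have heq : (B / (B * r ^ k * 2 ^ k)) ^ p = (2 ^ k)⁻¹ ^ n := by
    have h₁ : B / (B * r ^ k * 2 ^ k) = ((r * 2) ^ k)⁻¹ := by
      rw [mul_pow]
      field_simp
    rw [h₁, inv_pow_rpow_eq hp]
  linarith

end WeakBounds

/-- Sums growing geometrically up to index `K` and decaying geometrically afterwards. -/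
lemma sum_range_le_of_geometric {u : ℕ → ℝ} {b r : ℝ} (hb : 0 < b) (hr : 1 < r) {K : ℕ}
    (h₁ : ∀ k, u k ≤ b * r ^ k) (h₂ : ∀ i, u (K + i) ≤ b * r ^ K * (3 / 4) ^ i) (M : ℕ) :
    ∑ k ∈ Finset.range M, u k ≤ b * r ^ K * (1 / (r - 1) + 4) := by
  have hr' : 0 < r - 1 := by linarith
  have hlow (M : ℕ) : ∑ k ∈ Finset.range M, u k ≤ b * r ^ M * (1 / (r - 1)) := by
    refine (Finset.sum_le_sum fun k _ => h₁ k).trans ?_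
    rw [← Finset.mul_sum, geom_sum_eq hr.ne', mul_assoc, mul_one_div]
    gcongr
    linarith
  rcases le_total M K with h | h
  · refine (hlow M).trans ?_
    gcongr
    · exact hr.le
    · linarith
  · obtain ⟨i, rfl⟩ := Nat.exists_eq_add_of_le h
    rw [Finset.sum_range_add, mul_add]
    refine add_le_add (hlow K) ((Finset.sum_le_sum fun k _ => h₂ k).trans ?_)
    rw [← Finset.mul_sum, geom_sum_eq (by norm_num)]
    gcongr
    have : (0 : ℝ) ≤ (3 / 4) ^ i := by positivity
    rw [div_le_iff_of_neg (by norm_num)]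
    linarith

section Superlevel

variable {n : ℕ} {c : Fin n → ℝ} {f : (Fin n → ℝ) → ℝ} {p B : ℝ}

lemma volume_oscSuperlevel_geometric_le (hp : 1 ≤ p) (hB : 0 < B)
    (hA : OpNormPow n c p f ≤ ENNReal.ofReal (B ^ p)) (K i : ℕ) :
    volume (oscSuperlevel c f (K + i) (B * ((2 : ℝ) ^ ((n - p) / p)) ^ K * (3 / 4) ^ i))
      ≤ ENNReal.ofReal ((2 ^ K)⁻¹ ^ n * (2 / 3) ^ i) := by
  set r := (2 : ℝ) ^ ((n - p) / p) with hr
  have hr0 : 0 < r := by positivity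
  refine (volume_oscSuperlevel_le hB hA _ (by positivity)).trans (ENNReal.ofReal_le_ofReal ?_)
  have h₁ : B / (B * r ^ K * (3 / 4) ^ i * 2 ^ (K + i)) = ((r * 2) ^ K)⁻¹ * (2 / 3) ^ i := by
    rw [mul_pow, pow_add, show (2 / 3 : ℝ) = (3 / 4 * 2)⁻¹ by norm_num, inv_pow, mul_pow (3 / 4)]
    field_simp
  rw [h₁, Real.mul_rpow (by positivity) (by positivity), inv_pow_rpow_eq (by linarith)]
  gcongr
  exact Real.rpow_le_self_of_le_one (by positivity)
    (pow_le_one₀ (by norm_num) (by norm_num)) hp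

lemma volume_superlevel_le (hp : 1 ≤ p) (hpn : p < n) (hB : 0 < B)
    (hf : IntegrableOn f (unitCube n c))
    (hA : OpNormPow n c p f ≤ ENNReal.ofReal (B ^ p)) (K : ℕ) {l : ℝ}
    (hl : 2 ^ n * (1 / ((2 : ℝ) ^ ((n - p) / p) - 1) + 4) * B * ((2 : ℝ) ^ ((n - p) / p)) ^ K
      ≤ l) :
    volume {x ∈ unitCube n c | l < |f x - ⨍ y in unitCube n c, f y|}
      ≤ ENNReal.ofReal (3 * (2 ^ K)⁻¹ ^ n) := by
  have hp0 : 0 < p := by linarith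
  have hr1 : 1 < (2 : ℝ) ^ ((n - p) / p) :=
    Real.one_lt_rpow one_lt_two (div_pos (by linarith) hp0)
  set r := (2 : ℝ) ^ ((n - p) / p) with hr
  have hsub : ({x ∈ unitCube n c | l < |f x - ⨍ y in unitCube n c, f y|} : Set _) ≤ᵐ[volume]
      ⋃ i, oscSuperlevel c f (K + i) (B * r ^ K * (3 / 4) ^ i) := by
    filter_upwards [ae_abs_sub_average_le hf] with x hx hmem
    by_contra hnot
    obtain ⟨hxQ, hlx⟩ : x ∈ unitCube n c ∧ l < |f x - ⨍ y in unitCube n c, f y| := hmem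
    have hgood (i : ℕ) : osc f (dyadicCube c (K + i) x) ≤ B * r ^ K * (3 / 4) ^ i := by
      by_contra! h
      exact hnot (mem_iUnion.2 ⟨i, dyadicCube_subset_oscSuperlevel hxQ h (mem_dyadicCube hxQ)⟩)
    have := hx hxQ _ (sum_range_le_of_geometric hB hr1
      (osc_dyadicCube_le hp0 hB hA hxQ) hgood)
    linarith
  refine (measure_mono_ae hsub).trans ((measure_iUnion_le _).trans ?_)
  refine (ENNReal.tsum_le_tsum fun i => volume_oscSuperlevel_geometric_le hp hB hA K i).trans ?_
  have hs := (hasSum_geometric_of_lt_one (r := (2 / 3 : ℝ)) (by norm_num) (by norm_num)).mul_left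
    (((2 : ℝ) ^ K)⁻¹ ^ n)
  rw [← ENNReal.ofReal_tsum_of_nonneg (fun i => by positivity) hs.summable, hs.tsum_eq]
  refine ENNReal.ofReal_le_ofReal (le_of_eq ?_)
  norm_num
  ring

lemma mul_volume_superlevel_rpow_le (hp : 1 ≤ p) (hpn : p < n) (hB : 0 < B)
    (hf : IntegrableOn f (unitCube n c))
    (hA : OpNormPow n c p f ≤ ENNReal.ofReal (B ^ p)) {l : ℝ} (hl : 0 < l) :
    ENNReal.ofReal l *
        (volume {x ∈ unitCube n c | l < |f x - ⨍ y in unitCube n c, f y|})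
          ^ (((n : ℝ) - p) / ((n : ℝ) * p))
      ≤ ENNReal.ofReal (2 ^ n * (1 / ((2 : ℝ) ^ ((n - p) / p) - 1) + 4) *
          (2 : ℝ) ^ ((n - p) / p) * 3 ^ (((n : ℝ) - p) / ((n : ℝ) * p)) * B) := by
  have hp0 : 0 < p := by linarith
  have hn0 : (0 : ℝ) < n := by linarith
  have hr1 : 1 < (2 : ℝ) ^ ((n - p) / p) :=
    Real.one_lt_rpow one_lt_two (div_pos (by linarith) hp0)
  have he0 : 0 < ((n : ℝ) - p) / ((n : ℝ) * p) := div_pos (by linarith) (by positivity)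
  have hre : (2 : ℝ) ^ ((n - p) / p) = (2 ^ n) ^ (((n : ℝ) - p) / ((n : ℝ) * p)) := by
    rw [← Real.rpow_natCast, ← Real.rpow_mul zero_le_two]
    congr 1
    field_simp
  set e := ((n : ℝ) - p) / ((n : ℝ) * p)
  set r := (2 : ℝ) ^ ((n - p) / p) with hr
  set D : ℝ := 2 ^ n * (1 / (r - 1) + 4) with hD
  have hD0 : 0 < D := by
    have : 0 < r - 1 := by linarith
    positivity
  have h3 : (1 : ℝ) ≤ 3 ^ e := Real.one_le_rpow (by norm_num) he0.le
  rcases lt_or_ge l (D * B) with hlD | hlD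
  · have hv : volume {x ∈ unitCube n c | l < |f x - ⨍ y in unitCube n c, f y|} ^ e ≤ 1 :=
      ENNReal.rpow_le_one ((measure_mono (sep_subset _ _)).trans volume_unitCube.le) he0.le
    refine (mul_le_of_le_one_right' hv).trans (ENNReal.ofReal_le_ofReal ?_)
    have : (1 : ℝ) ≤ r * 3 ^ e := one_le_mul_of_one_le_of_one_le hr1.le h3
    nlinarith [mul_pos hD0 hB]
  · obtain ⟨K, hK₁, hK₂⟩ := exists_nat_pow_near ((one_le_div (by positivity)).2 hlD) hr1
    rw [le_div_iff₀ (by positivity)] at hK₁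
    rw [div_lt_iff₀ (by positivity)] at hK₂
    have hv := volume_superlevel_le hp hpn hB hf hA K (l := l) (by
      rw [← hr, ← hD]
      linarith)
    have hpow : (3 * ((2 : ℝ) ^ K)⁻¹ ^ n) ^ e = 3 ^ e * (r ^ K)⁻¹ := by
      rw [Real.mul_rpow (by norm_num) (by positivity), hre, ← inv_pow, ← pow_mul, mul_comm K n,
        pow_mul, inv_pow, Real.rpow_pow_comm (by positivity), inv_pow, ← Real.inv_rpow
        (by positivity)]
    refine (mul_le_mul_right (ENNReal.rpow_le_rpow hv he0.le) _).trans ?_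
    rw [ENNReal.ofReal_rpow_of_nonneg (by positivity) he0.le, ← ENNReal.ofReal_mul hl.le, hpow]
    refine ENNReal.ofReal_le_ofReal ?_
    calc l * (3 ^ e * (r ^ K)⁻¹) ≤ (r ^ (K + 1) * (D * B)) * (3 ^ e * (r ^ K)⁻¹) := by gcongr
      _ = D * r * 3 ^ e * B := by
        rw [pow_succ]
        field_simp

end Superlevel

/-- weak Sobolev–Poincaré inequality.  For `n ≥ 2`, `1 ≤ p < n` and
`p* = np/(n-p)`, for every unit cube `Q₀` and every `f ∈ L¹(Q₀)`,
`sup_{λ>0} λ |{x ∈ Q₀ : |f - f_{Q₀}| > λ}|^{1/p*} ≤ C ‖f‖_{𝒪^p(Q₀)}`. -/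
theorem statement0 (n : ℕ) (hn : 2 ≤ n) (p : ℝ) (hp1 : 1 ≤ p) (hpn : p < n) :
    ∃ C : ℝ, 0 < C ∧
      ∀ (c : Fin n → ℝ) (f : (Fin n → ℝ) → ℝ), IntegrableOn f (unitCube n c) →
      (⨆ l ∈ Set.Ioi (0 : ℝ), ENNReal.ofReal l *
          (volume {x ∈ unitCube n c | l < |f x - ⨍ y in unitCube n c, f y|})
            ^ (((n : ℝ) - p) / ((n : ℝ) * p)))
        ≤ ENNReal.ofReal C * (OpNormPow n c p f) ^ (1 / p) := by
  have hp0 : 0 < p := by linarith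
  have hr1 : 0 < (2 : ℝ) ^ ((n - p) / p) - 1 :=
    sub_pos.2 (Real.one_lt_rpow one_lt_two (div_pos (by linarith) hp0))
  set C : ℝ := 2 ^ n * (1 / ((2 : ℝ) ^ ((n - p) / p) - 1) + 4) *
          (2 : ℝ) ^ ((n - p) / p) * 3 ^ (((n : ℝ) - p) / ((n : ℝ) * p)) with hC
  have hC0 : 0 < C := by positivity
  refine ⟨C, hC0, fun c f hf => iSup₂_le fun l hl => ?_⟩
  rcases eq_or_ne (OpNormPow n c p f) ∞ with htop | hfin
  · rw [htop, ENNReal.top_rpow_of_pos (by positivity), ENNReal.mul_top (by simpa using hC0)]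
    exact le_top
  have hN : OpNormPow n c p f ^ (1 / p) ≠ ∞ := ENNReal.rpow_ne_top_of_nonneg (by positivity) hfin
  refine ENNReal.le_of_forall_pos_le_add fun ε hε _ => ?_
  have hε' : (0 : ℝ) < ε := hε
  set N := (OpNormPow n c p f ^ (1 / p)).toReal with hNdef
  have hN0 : 0 ≤ N := ENNReal.toReal_nonneg
  have hB : 0 < N + ε / C := by positivity
  have hA : OpNormPow n c p f ≤ ENNReal.ofReal ((N + ε / C) ^ p) := by
    rw [← ENNReal.ofReal_rpow_of_pos hB, ← ENNReal.rpow_inv_le_iff hp0, ← one_div,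
      ← ENNReal.ofReal_toReal hN]
    exact ENNReal.ofReal_le_ofReal (by rw [← hNdef]; linarith [div_pos hε' hC0])
  refine (mul_volume_superlevel_rpow_le hp1 hpn hB hf hA hl).trans ?_
  rw [← hC, ← ENNReal.ofReal_toReal hN, ← hNdef, ← ENNReal.ofReal_mul hC0.le,
    ← ENNReal.ofReal_coe_nnreal, ← ENNReal.ofReal_add (by positivity) hε'.le]
  refine ENNReal.ofReal_le_ofReal (le_of_eq ?_)
  field_simp
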